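/- arXiv:math/0510606 — 2 statements merged into one kernel-verified Lean document; each statement's English description precedes it below -/
import Mathlib

section
/- Fix M > 1 and τ ∈ [0,1]; let c = 2/(1 + M^{−τ}), let J(t) be the rotation matrix with rows (cos t, −sin t) and (sin t, cos t), define for x ≠ 0: K_τ(x) = Id if arg x ∈ [0, cπ/2) ∪ [π, π + cπ/2) and K_τ(x) = diag(M, M^{1−2τ}) otherwise, and set A_τ(x) = J(arg x) K_τ(x) J(arg x)^T. Define f(x, ρ) = (1/(2π)) ∫₀^{2π} ⟨e^{it}, A_τ(x + ρe^{it}) e^{it}⟩ / √(det A_τ(x + ρe^{it})) dt. Then for every x ∈ ℝ² with |x| < 1 and with no restriction on M > 1, f(x, 1) ≤ f(0, 1). -/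
open MeasureTheory Real Set Matrix intervalIntegral
open scoped Classical

noncomputable section

abbrev V2 := EuclideanSpace ℝ (Fin 2)

def toV (v : Fin 2 → ℝ) : V2 := (WithLp.equiv 2 (Fin 2 → ℝ)).symm v

def dot2 (v w : Fin 2 → ℝ) : ℝ := v 0 * w 0 + v 1 * w 1

def quad (A : Matrix (Fin 2) (Fin 2) ℝ) (ξ : Fin 2 → ℝ) : ℝ := dot2 ξ (A.mulVec ξ)

def eit (t : ℝ) : V2 := toV ![Real.cos t, Real.sin t]

/-- The angular polar coordinate `arg y ∈ [0, 2π)` of `y ∈ ℝ²` (with `arg 0 = 0`). -/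
def arg2 (x : V2) : ℝ :=
  if 0 ≤ Complex.arg (Complex.mk (x 0) (x 1)) then Complex.arg (Complex.mk (x 0) (x 1))
  else Complex.arg (Complex.mk (x 0) (x 1)) + 2 * π

/-- The rotation matrix `J(t)`. -/
def Jmat (t : ℝ) : Matrix (Fin 2) (Fin 2) ℝ :=
  !![Real.cos t, -Real.sin t; Real.sin t, Real.cos t]

/-- `c = 2/(1 + M^{−τ})`. -/
def cM (M τ : ℝ) : ℝ := 2 / (1 + M ^ (-τ))

/-- The piecewise-constant matrix `K_τ`: the identity on the cone
`arg x ∈ [0, cπ/2) ∪ [π, π + cπ/2)` and `diag(M, M^{1−2τ})` otherwise. -/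
def Ktau (M τ : ℝ) (x : V2) : Matrix (Fin 2) (Fin 2) ℝ :=
  if arg2 x ∈ Ico 0 (cM M τ * π / 2) ∪ Ico π (π + cM M τ * π / 2) then 1
  else Matrix.diagonal ![M, M ^ (1 - 2 * τ)]

/-- The coefficient matrix `A_τ(x) = J(arg x) K_τ(x) J(arg x)ᵀ`. -/
def Atau (M τ : ℝ) (x : V2) : Matrix (Fin 2) (Fin 2) ℝ :=
  Jmat (arg2 x) * Ktau M τ x * (Jmat (arg2 x))ᵀ

/-- `f(x, ρ) = (1/2π) ∫₀^{2π} ⟨e^{it}, A_τ(x + ρe^{it}) e^{it}⟩ / √(det A_τ(x + ρe^{it})) dt`. -/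
def ftau (M τ : ℝ) (x : V2) (ρ : ℝ) : ℝ :=
  (1 / (2 * π)) * ∫ t in (0 : ℝ)..(2 * π),
    quad (Atau M τ (x + ρ • eit t)) (eit t) / Real.sqrt ((Atau M τ (x + ρ • eit t)).det)

lemma cos_arg2 (y : V2) : cos (arg2 y) = cos (Complex.arg (Complex.mk (y 0) (y 1))) := by
  unfold arg2; split_ifs <;> simp

lemma sin_arg2 (y : V2) : sin (arg2 y) = sin (Complex.arg (Complex.mk (y 0) (y 1))) := by
  unfold arg2; split_ifs <;> simp

lemma apply_zero_eq_norm_mul_cos_arg2 (y : V2) :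
    y 0 = ‖Complex.mk (y 0) (y 1)‖ * cos (arg2 y) := by
  rw [cos_arg2, Complex.norm_mul_cos_arg]

lemma apply_one_eq_norm_mul_sin_arg2 (y : V2) :
    y 1 = ‖Complex.mk (y 0) (y 1)‖ * sin (arg2 y) := by
  rw [sin_arg2, Complex.norm_mul_sin_arg]

lemma arg2_eq_of_polar {y : V2} {r θ : ℝ} (hr : 0 < r) (hθ : θ ∈ Ico 0 (2 * π))
    (h0 : y 0 = r * cos θ) (h1 : y 1 = r * sin θ) : arg2 y = θ := by
  have hy : Complex.mk (y 0) (y 1) = r * (Complex.cos θ + Complex.sin θ * Complex.I) := by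
    rw [h0, h1]
    apply Complex.ext <;> simp [← Complex.ofReal_cos, ← Complex.ofReal_sin]
  have hpi := pi_pos
  unfold arg2
  rw [hy]
  rcases le_or_gt θ π with h | h
  · rw [Complex.arg_mul_cos_add_sin_mul_I hr ⟨by linarith [hθ.1], h⟩, if_pos hθ.1]
  · have hs : (r : ℂ) * (Complex.cos θ + Complex.sin θ * Complex.I) =
        r * (Complex.cos (θ - 2 * π : ℝ) + Complex.sin (θ - 2 * π : ℝ) * Complex.I) := by
      push_cast
      rw [Complex.cos_sub_two_pi, Complex.sin_sub_two_pi]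
    rw [hs, Complex.arg_mul_cos_add_sin_mul_I hr ⟨by linarith, by linarith [hθ.2]⟩,
      if_neg (by linarith [hθ.2])]
    ring

lemma eit_apply_zero (t : ℝ) : eit t 0 = cos t := rfl

lemma eit_apply_one (t : ℝ) : eit t 1 = sin t := rfl

lemma norm_sq_V2 (x : V2) : ‖x‖ ^ 2 = x 0 ^ 2 + x 1 ^ 2 := by
  rw [EuclideanSpace.real_norm_sq_eq, Fin.sum_univ_two]

/-- The parameter `t` at which the ray from the origin in direction `θ` meets the unit circle
centred at `x`, when `‖x‖ < 1`. -/
def circleParam (x : V2) (θ : ℝ) : ℝ := θ + arcsin (x 0 * sin θ - x 1 * cos θ)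

lemma continuous_circleParam (x : V2) : Continuous (circleParam x) := by
  unfold circleParam
  exact continuous_id.add (continuous_arcsin.comp (by fun_prop))

lemma circleParam_add_pi (x : V2) (θ : ℝ) :
    circleParam x (θ + π) = θ + π - arcsin (x 0 * sin θ - x 1 * cos θ) := by
  rw [circleParam, sin_add_pi, cos_add_pi, sub_eq_add_neg (θ + π), ← arcsin_neg]
  congr 2
  ring

lemma arg2_add_eit_circleParam {x : V2} (hx : ‖x‖ < 1) {θ : ℝ} (hθ : θ ∈ Ico 0 (2 * π)) :
    arg2 (x + (1 : ℝ) • eit (circleParam x θ)) = θ := by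
  set s := x 0 * sin θ - x 1 * cos θ with hs
  have hn : x 0 ^ 2 + x 1 ^ 2 < 1 := by
    rw [← norm_sq_V2]
    nlinarith [norm_nonneg x]
  have hsq : (x 0 * cos θ + x 1 * sin θ) ^ 2 + s ^ 2 = x 0 ^ 2 + x 1 ^ 2 := by
    rw [hs]
    linear_combination (x 0 ^ 2 + x 1 ^ 2) * sin_sq_add_cos_sq θ
  have hlt : |x 0 * cos θ + x 1 * sin θ| < √(1 - s ^ 2) := by
    apply Real.lt_sqrt_of_sq_lt
    rw [sq_abs]
    linarith
  have hs1 : s ^ 2 < 1 := by nlinarith [sq_nonneg (x 0 * cos θ + x 1 * sin θ)]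
  have hs2 : |s| < 1 := by rwa [← sq_lt_one_iff_abs_lt_one]
  have hsin : sin (arcsin s) = s := sin_arcsin (abs_lt.1 hs2).1.le (abs_lt.1 hs2).2.le
  refine arg2_eq_of_polar (r := √(1 - s ^ 2) + (x 0 * cos θ + x 1 * sin θ))
    (by linarith [(abs_lt.1 hlt).1]) hθ ?_ ?_
  · change x 0 + 1 * cos (θ + arcsin s) = _
    rw [cos_add, hsin, cos_arcsin, hs]
    linear_combination (-x 0) * sin_sq_add_cos_sq θ
  · change x 1 + 1 * sin (θ + arcsin s) = _
    rw [sin_add, hsin, cos_arcsin, hs]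
    linear_combination (-x 1) * sin_sq_add_cos_sq θ

/-- A function which, along the unit circle centred at `x`, takes a constant value on the sector
`α < arg < β` integrates over the corresponding arc to that value times the arc length. -/
lemma integral_comp_arg2_arc {x : V2} (hx : ‖x‖ < 1) {α β k : ℝ} (hα : 0 ≤ α) (hαβ : α ≤ β)
    (hβ : β ≤ 2 * π) {φ : ℝ → ℝ} (hφ : ∀ θ ∈ Ioo α β, φ θ = k) :
    IntervalIntegrable (fun t => φ (arg2 (x + (1 : ℝ) • eit t))) volume
      (circleParam x α) (circleParam x β) ∧
    ∫ t in circleParam x α..circleParam x β, φ (arg2 (x + (1 : ℝ) • eit t)) =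
      k * (circleParam x β - circleParam x α) := by
  have hae : ∀ᵐ t, t ∈ uIoc (circleParam x α) (circleParam x β) →
      k = φ (arg2 (x + (1 : ℝ) • eit t)) := by
    filter_upwards [Measure.ae_ne volume (circleParam x α),
      Measure.ae_ne volume (circleParam x β)] with t h1 h2 ht
    obtain ⟨θ, hθ, rfl⟩ :=
      intermediate_value_uIcc (continuous_circleParam x).continuousOn (uIoc_subset_uIcc ht)
    rw [uIcc_of_le hαβ] at hθ
    have hθα : α < θ := lt_of_le_of_ne hθ.1 fun h => h1 (by rw [h])
    have hθβ : θ < β := lt_of_le_of_ne hθ.2 fun h => h2 (by rw [h])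
    rw [arg2_add_eit_circleParam hx ⟨hα.trans hθ.1, hθβ.trans_le hβ⟩, hφ θ ⟨hθα, hθβ⟩]
  constructor
  · refine (intervalIntegrable_const (c := k)).congr_ae ?_
    rwa [Filter.EventuallyEq, ae_restrict_iff' measurableSet_uIoc]
  · rw [← intervalIntegral.integral_congr_ae hae, intervalIntegral.integral_const, smul_eq_mul,
      mul_comm]

/-- The weight equal to `1` on `[0, γ) ∪ [π, π + γ)` and to `m` elsewhere. -/
def coneWeight (γ m θ : ℝ) : ℝ := if θ ∈ Ico 0 γ ∪ Ico π (π + γ) then 1 else m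

lemma coneWeight_nonneg {γ m : ℝ} (hm : 0 ≤ m) (θ : ℝ) : 0 ≤ coneWeight γ m θ := by
  unfold coneWeight; split_ifs <;> positivity

lemma eit_periodic : Function.Periodic eit (2 * π) := fun t => by simp [eit]

/-- A double cone with apex inside the unit circle cuts out arcs of total length twice the sum of
its opening angles, independently of the apex. -/
lemma integral_coneWeight {x : V2} (hx : ‖x‖ < 1) {γ m : ℝ} (hγ0 : 0 ≤ γ) (hγ : γ ≤ π) :
    IntervalIntegrable (fun t => coneWeight γ m (arg2 (x + (1 : ℝ) • eit t))) volume 0 (2 * π) ∧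
    ∫ t in (0 : ℝ)..(2 * π), coneWeight γ m (arg2 (x + (1 : ℝ) • eit t)) =
      2 * γ + 2 * (π - γ) * m := by
  have hpi := pi_pos
  have hper : Function.Periodic
      (fun t => coneWeight γ m (arg2 (x + (1 : ℝ) • eit t))) (2 * π) := fun t => by
    simp only [eit_periodic t]
  obtain ⟨i1, e1⟩ := integral_comp_arg2_arc hx le_rfl hγ0 (by linarith)
    (φ := coneWeight γ m) (k := 1) fun θ hθ => if_pos (Or.inl ⟨hθ.1.le, hθ.2⟩)
  obtain ⟨i2, e2⟩ := integral_comp_arg2_arc hx hγ0 hγ (by linarith)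
    (φ := coneWeight γ m) (k := m) fun θ hθ => if_neg (by
      rintro (h | h)
      · linarith [h.2, hθ.1]
      · linarith [h.1, hθ.2])
  obtain ⟨i3, e3⟩ := integral_comp_arg2_arc hx hpi.le (by linarith : π ≤ γ + π) (by linarith)
    (φ := coneWeight γ m) (k := 1)
    fun θ hθ => if_pos (Or.inr ⟨hθ.1.le, by linarith [hθ.2]⟩)
  obtain ⟨i4, e4⟩ := integral_comp_arg2_arc hx (by linarith)
    (by linarith : γ + π ≤ 2 * π) le_rfl
    (φ := coneWeight γ m) (k := m) fun θ hθ => if_neg (by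
      rintro (h | h)
      · linarith [h.2, hθ.1]
      · linarith [h.2, hθ.1])
  have hend : circleParam x (2 * π) = circleParam x 0 + 2 * π := by
    simp [circleParam]
    ring
  have hp := circleParam_add_pi x 0
  rw [zero_add] at hp
  have hloop := ((i1.trans i2).trans i3).trans i4
  have hsum := intervalIntegral.integral_add_adjacent_intervals ((i1.trans i2).trans i3) i4
  rw [← intervalIntegral.integral_add_adjacent_intervals (i1.trans i2) i3,
    ← intervalIntegral.integral_add_adjacent_intervals i1 i2, e1, e2, e3, e4] at hsum
  rw [hend] at hsum hloop
  constructor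
  · exact hper.intervalIntegrable two_pi_pos.ne' hloop 0 (2 * π)
  · have h := hper.intervalIntegral_add_eq 0 (circleParam x 0)
    rw [zero_add] at h
    rw [h, ← hsum, circleParam_add_pi, hp]
    simp only [circleParam, zero_add]
    ring

lemma quad_rotate_diagonal (θ t a b : ℝ) :
    quad (Jmat θ * Matrix.diagonal ![a, b] * (Jmat θ)ᵀ) (eit t) =
      a * cos (t - θ) ^ 2 + b * sin (t - θ) ^ 2 := by
  have hd : Matrix.diagonal ![a, b] = !![a, 0; 0, b] := by
    ext i j
    fin_cases i <;> fin_cases j <;> simp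
  rw [cos_sub, sin_sub, hd]
  simp [quad, dot2, Jmat, Matrix.mulVec, dotProduct, Matrix.mul_apply, Fin.sum_univ_two,
    eit_apply_zero, eit_apply_one]
  ring

lemma det_rotate_diagonal (θ a b : ℝ) :
    (Jmat θ * Matrix.diagonal ![a, b] * (Jmat θ)ᵀ).det = a * b := by
  have h : (Jmat θ).det = 1 := by
    rw [Jmat, Matrix.det_fin_two_of]
    linear_combination sin_sq_add_cos_sq θ
  rw [Matrix.det_mul, Matrix.det_mul, Matrix.det_transpose, h, Matrix.det_diagonal]
  simp

lemma quad_Atau_div_sqrt_det {M τ : ℝ} (hM : 0 < M) (y : V2) (t : ℝ) :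
    quad (Atau M τ y) (eit t) / √(Atau M τ y).det =
      coneWeight (cM M τ * π / 2) (M ^ τ * cos (t - arg2 y) ^ 2 + M ^ (-τ) * sin (t - arg2 y) ^ 2)
        (arg2 y) := by
  unfold Atau Ktau coneWeight
  split_ifs with h
  · have h1 : (1 : Matrix (Fin 2) (Fin 2) ℝ) = Matrix.diagonal ![1, 1] := by
      ext i j; fin_cases i <;> fin_cases j <;> simp
    rw [h1, quad_rotate_diagonal, det_rotate_diagonal]
    simp
  · have hsqrt : √(M * M ^ (1 - 2 * τ)) = M ^ (1 - τ) := by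
      rw [sqrt_eq_iff_mul_self_eq_of_pos (by positivity), ← rpow_add hM]
      nth_rewrite 2 [← rpow_one M]
      rw [← rpow_add hM]
      ring_nf
    rw [quad_rotate_diagonal, det_rotate_diagonal, hsqrt, add_div, mul_div_right_comm,
      mul_div_right_comm, ← rpow_sub hM]
    congr 3
    · rw [div_eq_iff (by positivity), ← rpow_add hM]
      simp
    · ring

/-- For every fixed `M > 1` and `τ ∈ [0, 1]`, and every `x` with `|x| < 1`
(with no restriction on `M`), one has `f(x, 1) ≤ f(0, 1)`. -/
theorem stmt9 (M τ : ℝ) (hM : 1 < M) (hτ0 : 0 ≤ τ) (hτ1 : τ ≤ 1)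
    (x : V2) (hx : ‖x‖ < 1) :
    ftau M τ x 1 ≤ ftau M τ 0 1 := by
  have hM0 : 0 < M := by linarith
  have hpi := pi_pos
  have hinv : M ^ (-τ) ≤ 1 := rpow_le_one_of_one_le_of_nonpos hM.le (by linarith)
  have hinv0 : 0 < M ^ (-τ) := by positivity
  have hm : 1 ≤ M ^ τ := one_le_rpow hM.le hτ0
  have hc0 : 0 < cM M τ := by unfold cM; positivity
  have hc2 : cM M τ ≤ 2 := by
    unfold cM
    rw [div_le_iff₀ (by positivity)]
    linarith
  have hγ0 : 0 ≤ cM M τ * π / 2 := by positivity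
  have hγ : cM M τ * π / 2 ≤ π := by nlinarith
  unfold ftau
  refine mul_le_mul_of_nonneg_left ?_ (by positivity)
  simp only [quad_Atau_div_sqrt_det hM0]
  obtain ⟨hi, he⟩ := integral_coneWeight hx (m := M ^ τ) hγ0 hγ
  have h0 : ∀ t, cos (t - arg2 (0 + (1 : ℝ) • eit t)) ^ 2 = 1 ∧
      sin (t - arg2 (0 + (1 : ℝ) • eit t)) ^ 2 = 0 := by
    intro t
    have hn : ‖Complex.mk (cos t) (sin t)‖ = 1 := by
      rw [Complex.norm_def, Complex.normSq_mk, sqrt_eq_one]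
      linear_combination sin_sq_add_cos_sq t
    have hc := apply_zero_eq_norm_mul_cos_arg2 (eit t)
    have hs := apply_one_eq_norm_mul_sin_arg2 (eit t)
    rw [eit_apply_zero, eit_apply_one, hn, one_mul] at hc hs
    rw [zero_add, one_smul, cos_sub, sin_sub, ← hc, ← hs]
    constructor
    · have := sin_sq_add_cos_sq t
      rw [show cos t * cos t + sin t * sin t = 1 by linarith]
      norm_num
    · ring
  have hzero := (integral_coneWeight (x := 0) (by simp) (m := M ^ τ) hγ0 hγ).2
  simp only [fun t => (h0 t).1, fun t => (h0 t).2, mul_one, mul_zero, add_zero]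
  rw [hzero, ← he, integral_of_le two_pi_pos.le, integral_of_le two_pi_pos.le]
  refine integral_mono_of_nonneg (Filter.Eventually.of_forall fun t => ?_)
    ((intervalIntegrable_iff_integrableOn_Ioc_of_le two_pi_pos.le).1 hi)
    (Filter.Eventually.of_forall fun t => ?_)
  · exact coneWeight_nonneg (by positivity) _
  · dsimp only
    unfold coneWeight
    split_ifs
    · exact le_rfl
    · have := sin_sq_add_cos_sq (t - arg2 (x + (1 : ℝ) • eit t))
      nlinarith [sq_nonneg (sin (t - arg2 (x + (1 : ℝ) • eit t)))]
end
end

section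
/- Fix M > 1 and τ ∈ [0,1]; let c = 2/(1 + M^{−τ}), let J(t) be the rotation matrix with rows (cos t, −sin t) and (sin t, cos t), define for x ≠ 0: K_τ(x) = Id if arg x ∈ [0, cπ/2) ∪ [π, π + cπ/2) and K_τ(x) = diag(M, M^{1−2τ}) otherwise, and set A_τ(x) = J(arg x) K_τ(x) J(arg x)^T. Then (1/(2π)) ∫₀^{2π} ⟨e^{it}, A_τ(e^{it}) e^{it}⟩ / √(det A_τ(e^{it})) dt = 2/(1 + M^{−τ}). -/
open MeasureTheory Real Set Matrix intervalIntegral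
open scoped Classical

noncomputable section

theorem arg2_eit {t : ℝ} (h0 : 0 ≤ t) (h1 : t < 2 * π) : arg2 (eit t) = t := by
  have hz (s : ℝ) (hc : Real.cos s = Real.cos t) (hs : Real.sin s = Real.sin t) :
      Complex.mk (eit t 0) (eit t 1) = Complex.cos s + Complex.sin s * Complex.I := by
    rw [← Complex.ofReal_cos, ← Complex.ofReal_sin, hc, hs]
    apply Complex.ext <;> simp [eit, toV, -Complex.ofReal_cos, -Complex.ofReal_sin]
  unfold arg2
  have hπ := Real.pi_pos
  by_cases h : t ≤ π
  · rw [hz t rfl rfl, Complex.arg_cos_add_sin_mul_I ⟨by linarith, h⟩, if_pos h0]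
  · rw [hz (t - 2 * π) (Real.cos_sub_two_pi t) (Real.sin_sub_two_pi t),
      Complex.arg_cos_add_sin_mul_I ⟨by linarith, by linarith⟩, if_neg (by linarith)]
    ring

theorem quad_rotate_conj (K : Matrix (Fin 2) (Fin 2) ℝ) (t : ℝ) :
    quad (Jmat t * K * (Jmat t)ᵀ) (eit t) = K 0 0 := by
  have h := Real.sin_sq_add_cos_sq t
  simp [quad, dot2, Jmat, eit, toV, Matrix.mulVec, Matrix.vecMul, dotProduct,
    Matrix.mul_apply, Fin.sum_univ_two]
  linear_combination (K 0 0 * (Real.sin t ^ 2 + Real.cos t ^ 2) + K 0 0) * h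

theorem det_rotate_conj (K : Matrix (Fin 2) (Fin 2) ℝ) (t : ℝ) :
    (Jmat t * K * (Jmat t)ᵀ).det = K.det := by
  have h : (Jmat t).det = 1 := by
    rw [Jmat, Matrix.det_fin_two_of]
    linear_combination Real.sin_sq_add_cos_sq t
  rw [Matrix.det_mul, Matrix.det_mul, Matrix.det_transpose, h, one_mul, mul_one]

theorem integrand_eq {M τ t : ℝ} (hM : 0 < M) (h0 : 0 ≤ t) (h1 : t < 2 * π) :
    quad (Atau M τ (eit t)) (eit t) / Real.sqrt ((Atau M τ (eit t)).det) =
      if t ∈ Ico 0 (cM M τ * π / 2) ∪ Ico π (π + cM M τ * π / 2) then 1 else M ^ τ := by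
  rw [Atau, arg2_eit h0 h1, quad_rotate_conj, det_rotate_conj, Ktau, arg2_eit h0 h1]
  split_ifs
  · simp
  · have hsq : M * M ^ (1 - 2 * τ) = (M ^ (1 - τ)) ^ 2 := by
      rw [← Real.rpow_natCast, ← Real.rpow_mul hM.le]
      nth_rw 1 [← Real.rpow_one M]
      rw [← Real.rpow_add hM]
      congr 1
      push_cast
      ring
    have hdet : (Matrix.diagonal ![M, M ^ (1 - 2 * τ)]).det = (M ^ (1 - τ)) ^ 2 := by
      rw [Matrix.det_diagonal, Fin.prod_univ_two]
      exact hsq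
    rw [hdet, Real.sqrt_sq (Real.rpow_nonneg hM.le _), Matrix.diagonal_apply_eq,
      Matrix.cons_val_zero, div_eq_iff (Real.rpow_pos_of_pos hM _).ne', ← Real.rpow_add hM,
      add_sub_cancel, Real.rpow_one]

theorem integral_eq_of_const_on_Ioo {f : ℝ → ℝ} {a b k : ℝ} (hab : a ≤ b)
    (h : ∀ t ∈ Ioo a b, f t = k) :
    IntervalIntegrable f volume a b ∧ ∫ t in a..b, f t = k * (b - a) := by
  have hae : ∀ᵐ t, t ∈ uIoc a b → k = f t := by
    filter_upwards [Measure.ae_ne volume b] with t hne ht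
    rw [uIoc_of_le hab] at ht
    exact (h t ⟨ht.1, lt_of_le_of_ne ht.2 hne⟩).symm
  constructor
  · exact (intervalIntegrable_const (c := k)).congr_ae
      ((ae_restrict_iff' measurableSet_uIoc).2 hae)
  · rw [← intervalIntegral.integral_congr_ae hae, intervalIntegral.integral_const, smul_eq_mul,
      mul_comm]

/-- `(1/2π) ∫₀^{2π} ⟨e^{it}, A_τ(e^{it}) e^{it}⟩ / √(det A_τ(e^{it})) dt
= 2/(1 + M^{−τ})`, i.e. `f(0, 1) = c`. -/
theorem stmt10 (M τ : ℝ) (hM : 1 < M) (hτ0 : 0 ≤ τ) (hτ1 : τ ≤ 1) :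
    (1 / (2 * π)) * (∫ t in (0 : ℝ)..(2 * π),
        quad (Atau M τ (eit t)) (eit t) / Real.sqrt ((Atau M τ (eit t)).det)) =
      2 / (1 + M ^ (-τ)) := by
  have hπ := Real.pi_pos
  have hM0 : 0 < M := by linarith
  have ha : 0 < M ^ (-τ) := Real.rpow_pos_of_pos hM0 _
  have hinv : M ^ τ * M ^ (-τ) = 1 := by rw [← Real.rpow_add hM0]; simp
  have hc : cM M τ * (1 + M ^ (-τ)) = 2 := by
    rw [cM]
    field_simp
  have hc0 : 0 < cM M τ := by rw [cM]; positivity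
  have hc2 : cM M τ < 2 := by nlinarith
  set c := cM M τ with hcdef
  have hcp : 0 < c * π := by positivity
  have hcπ : c * π < 2 * π := by nlinarith
  set f : ℝ → ℝ := fun t =>
    quad (Atau M τ (eit t)) (eit t) / Real.sqrt ((Atau M τ (eit t)).det)
  have hval {t : ℝ} (h0 : 0 ≤ t) (h1 : t < 2 * π) :
      f t = if t ∈ Ico 0 (c * π / 2) ∪ Ico π (π + c * π / 2) then 1 else M ^ τ :=
    integrand_eq hM0 h0 h1
  obtain ⟨i1, e1⟩ := integral_eq_of_const_on_Ioo (f := f) (a := 0) (b := c * π / 2) (k := 1)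
    (by linarith) fun t ht => by
      exact (hval (by linarith [ht.1]) (by linarith [ht.2])).trans
        (if_pos (Or.inl ⟨ht.1.le, ht.2⟩))
  obtain ⟨i2, e2⟩ := integral_eq_of_const_on_Ioo (f := f) (a := c * π / 2) (b := π) (k := M ^ τ)
    (by linarith) fun t ht => by
      rw [hval (by linarith [ht.1]) (by linarith [ht.2]), if_neg]
      rintro (h | h)
      · linarith [ht.1, h.2]
      · linarith [ht.2, h.1]
  obtain ⟨i3, e3⟩ := integral_eq_of_const_on_Ioo (f := f) (a := π) (b := π + c * π / 2) (k := 1)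
    (by linarith) fun t ht => by
      exact (hval (by linarith [ht.1]) (by linarith [ht.2])).trans
        (if_pos (Or.inr ⟨ht.1.le, ht.2⟩))
  obtain ⟨i4, e4⟩ := integral_eq_of_const_on_Ioo (f := f) (a := π + c * π / 2) (b := 2 * π)
    (k := M ^ τ) (by linarith) fun t ht => by
      rw [hval (by linarith [ht.1]) (by linarith [ht.2]), if_neg]
      rintro (h | h)
      · linarith [ht.1, h.2]
      · linarith [ht.1, h.2]
  rw [← intervalIntegral.integral_add_adjacent_intervals i1 (i2.trans (i3.trans i4)),
    ← intervalIntegral.integral_add_adjacent_intervals i2 (i3.trans i4),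
    ← intervalIntegral.integral_add_adjacent_intervals i3 i4, e1, e2, e3, e4]
  change _ = cM M τ
  rw [← hcdef]
  have hmean : c / 2 + (1 - c / 2) * M ^ τ = c := by
    linear_combination (c / 2) * hinv - (M ^ τ / 2) * hc
  have hsum : 1 / (2 * π) * (1 * (c * π / 2 - 0) + (M ^ τ * (π - c * π / 2) +
      (1 * (π + c * π / 2 - π) + M ^ τ * (2 * π - (π + c * π / 2))))) =
      c / 2 + (1 - c / 2) * M ^ τ := by
    field_simp
    ring
  rw [hsum, hmean]
end
end
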